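/- There exists a constant c > 0 such that for all n, M ≥ 1, every type promise T ⊆ [M]^n, and every partial function f : T → Bool, the bounded-error randomized query complexity satisfies R(f) ≥ c · D(f)^{1/6}. -/

import Mathlib

open scoped Classical

namespace QCPaper

/-- A partial assignment `c` is consistent with the input `x` if it agrees with `x`
wherever it is defined. -/
def Consistent {n M : ℕ} (c : Fin n → Option (Fin M)) (x : Fin n → Fin M) : Prop :=
  ∀ i : Fin n, ∀ a : Fin M, c i = some a → x i = a

/-- The size of a partial assignment: the number of indices where it is defined. -/
def paSize {n M : ℕ} (c : Fin n → Option (Fin M)) : ℕ :=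
  (Finset.univ.filter fun i => c i ≠ none).card

/-- `c` is a certificate for the partial function `f` with promise `X`:
all inputs in `X` consistent with `c` get the same value under `f`. -/
def IsCertificate {n M : ℕ} (X : Set (Fin n → Fin M)) (f : (Fin n → Fin M) → Bool)
    (c : Fin n → Option (Fin M)) : Prop :=
  ∀ x ∈ X, ∀ y ∈ X, Consistent c x → Consistent c y → f x = f y

/-- The certificate complexity of `f` at the input `x`:
the least size of a certificate for `f` consistent with `x`. -/
noncomputable def Cx {n M : ℕ} (X : Set (Fin n → Fin M)) (f : (Fin n → Fin M) → Bool)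
    (x : Fin n → Fin M) : ℕ :=
  sInf {k | ∃ c : Fin n → Option (Fin M),
    IsCertificate X f c ∧ Consistent c x ∧ paSize c = k}

/-- The certificate complexity `C(f)`: the maximum of `Cx` over inputs in the promise. -/
noncomputable def certC {n M : ℕ} (X : Set (Fin n → Fin M))
    (f : (Fin n → Fin M) → Bool) : ℕ :=
  sSup {k | ∃ x ∈ X, Cx X f x = k}

/-- `b` is a sensitive block of `x` for `f` (with promise `X`). -/
def SensBlock {n M : ℕ} (X : Set (Fin n → Fin M)) (f : (Fin n → Fin M) → Bool)
    (x : Fin n → Fin M) (b : Finset (Fin n)) : Prop :=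
  ∃ y ∈ X, f y ≠ f x ∧ ∀ i : Fin n, y i ≠ x i → i ∈ b

/-- The block sensitivity of `f` at `x`: the largest number of pairwise disjoint
sensitive blocks of `x`. -/
noncomputable def bsx {n M : ℕ} (X : Set (Fin n → Fin M)) (f : (Fin n → Fin M) → Bool)
    (x : Fin n → Fin M) : ℕ :=
  sSup {m | ∃ b : Fin m → Finset (Fin n),
    (∀ j, SensBlock X f x (b j)) ∧ ∀ j j', j ≠ j' → Disjoint (b j) (b j')}

/-- The block sensitivity `bs(f)`. -/
noncomputable def bs {n M : ℕ} (X : Set (Fin n → Fin M))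
    (f : (Fin n → Fin M) → Bool) : ℕ :=
  sSup {m | ∃ x ∈ X, bsx X f x = m}

/-- The sensitivity of `f` at `x`: the largest number of pairwise disjoint
sensitive blocks of `x`, each of size 2. -/
noncomputable def sx {n M : ℕ} (X : Set (Fin n → Fin M)) (f : (Fin n → Fin M) → Bool)
    (x : Fin n → Fin M) : ℕ :=
  sSup {m | ∃ b : Fin m → Finset (Fin n),
    (∀ j, SensBlock X f x (b j) ∧ (b j).card = 2) ∧ ∀ j j', j ≠ j' → Disjoint (b j) (b j')}

/-- The sensitivity `s(f)`. -/
noncomputable def sens {n M : ℕ} (X : Set (Fin n → Fin M))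
    (f : (Fin n → Fin M) → Bool) : ℕ :=
  sSup {m | ∃ x ∈ X, sx X f x = m}

/-- The type of an input: the multiset of its entries. -/
def typeOf {n M : ℕ} (x : Fin n → Fin M) : Multiset (Fin M) :=
  Finset.univ.val.map x

/-- The multiplicity of the alphabet element `a` in the input `x`. -/
def mult {n M : ℕ} (x : Fin n → Fin M) (a : Fin M) : ℕ :=
  (Finset.univ.filter fun i => x i = a).card

/-- A type promise: the (nonempty) set of all strings with one fixed type. -/
def IsTypePromise {n M : ℕ} (T : Set (Fin n → Fin M)) : Prop :=
  ∃ x₀ : Fin n → Fin M, T = {x | typeOf x = typeOf x₀}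

/-- Decision trees over `[M]^n`: either a leaf with a Boolean answer, or a query
to an index together with a subtree for each possible answer. -/
inductive DTree (n M : ℕ) : Type
  | leaf : Bool → DTree n M
  | node : Fin n → (Fin M → DTree n M) → DTree n M

/-- Evaluation of a decision tree on an input. -/
def DTree.eval {n M : ℕ} : DTree n M → (Fin n → Fin M) → Bool
  | .leaf b, _ => b
  | .node i ts, x => (ts (x i)).eval x

/-- The cost of a decision tree on an input: the number of queries made. -/
def DTree.cost {n M : ℕ} : DTree n M → (Fin n → Fin M) → ℕ
  | .leaf _, _ => 0
  | .node i ts, x => (ts (x i)).cost x + 1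

/-- The depth of a decision tree: its maximum cost over all inputs. -/
def DTree.depth {n M : ℕ} : DTree n M → ℕ
  | .leaf _ => 0
  | .node _ ts => (Finset.univ.sup fun a => (ts a).depth) + 1

/-- The tree `t` computes `f` on the promise `X`. -/
def Computes {n M : ℕ} (X : Set (Fin n → Fin M)) (f : (Fin n → Fin M) → Bool)
    (t : DTree n M) : Prop :=
  ∀ x ∈ X, t.eval x = f x

/-- The deterministic query complexity `D(f)`:
the least depth of a decision tree computing `f`. -/
noncomputable def detD {n M : ℕ} (X : Set (Fin n → Fin M))
    (f : (Fin n → Fin M) → Bool) : ℕ :=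
  sInf {d | ∃ t : DTree n M, Computes X f t ∧ t.depth = d}

/-- A finitely supported probability distribution over decision trees,
given as a finite list of trees with probabilities. -/
structure RandAlg (n M : ℕ) where
  N : ℕ
  tree : Fin N → DTree n M
  prob : Fin N → ℝ
  nonneg : ∀ j, 0 ≤ prob j
  sum_one : ∑ j, prob j = 1

/-- The expected cost of a randomized algorithm on the input `x`. -/
noncomputable def expCost {n M : ℕ} (A : RandAlg n M) (x : Fin n → Fin M) : ℝ :=
  ∑ j, A.prob j * ((A.tree j).cost x : ℝ)

/-- `A` is a zero-error randomized algorithm for `f`: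
every tree in its support computes `f`. -/
def ZeroError {n M : ℕ} (X : Set (Fin n → Fin M)) (f : (Fin n → Fin M) → Bool)
    (A : RandAlg n M) : Prop :=
  ∀ j, A.prob j ≠ 0 → Computes X f (A.tree j)

/-- The cost of a randomized algorithm: the maximum over inputs in the promise of
the expected cost. -/
noncomputable def algCost {n M : ℕ} (X : Set (Fin n → Fin M)) (A : RandAlg n M) : ℝ :=
  sSup {r | ∃ x ∈ X, r = expCost A x}

/-- The zero-error randomized query complexity `R₀(f)`:
the infimum cost of a zero-error randomized algorithm for `f`. -/
noncomputable def R0 {n M : ℕ} (X : Set (Fin n → Fin M))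
    (f : (Fin n → Fin M) → Bool) : ℝ :=
  sInf {r | ∃ A : RandAlg n M, ZeroError X f A ∧ algCost X A = r}

/-- `A` is a bounded-error randomized algorithm for `f`: on every input in the promise,
it returns the correct answer with probability at least 2/3. -/
def BoundedError {n M : ℕ} (X : Set (Fin n → Fin M)) (f : (Fin n → Fin M) → Bool)
    (A : RandAlg n M) : Prop :=
  ∀ x ∈ X, (2/3 : ℝ) ≤ ∑ j ∈ Finset.univ.filter fun j => (A.tree j).eval x = f x, A.prob j

/-- The depth of a randomized algorithm: the maximum depth of a tree in its support. -/
noncomputable def suppDepth {n M : ℕ} (A : RandAlg n M) : ℕ :=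
  (Finset.univ.filter fun j => A.prob j ≠ 0).sup fun j => (A.tree j).depth

/-- The bounded-error randomized query complexity `R(f)`:
the least depth of a bounded-error randomized algorithm for `f`. -/
noncomputable def randR {n M : ℕ} (X : Set (Fin n → Fin M))
    (f : (Fin n → Fin M) → Bool) : ℕ :=
  sInf {d | ∃ A : RandAlg n M, BoundedError X f A ∧ suppDepth A = d}

/-- A set of inputs is symmetric if it is invariant under permuting coordinates. -/
def SymmetricSet {n M : ℕ} (X : Set (Fin n → Fin M)) : Prop :=
  ∀ x ∈ X, ∀ σ : Equiv.Perm (Fin n), (x ∘ σ) ∈ X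

/-- A function is symmetric if its value depends only on the type of the input. -/
def SymmetricFun {n M : ℕ} (X : Set (Fin n → Fin M))
    (f : (Fin n → Fin M) → Bool) : Prop :=
  ∀ x ∈ X, ∀ y ∈ X, typeOf x = typeOf y → f x = f y

/-- The measure `d(f)` for a non-constant symmetric function: the least distance between
the types of two inputs in the promise with different values under `f`. -/
noncomputable def dgap {n M : ℕ} (X : Set (Fin n → Fin M))
    (f : (Fin n → Fin M) → Bool) : ℕ :=
  sInf {d | ∃ x ∈ X, ∃ y ∈ X, f x ≠ f y ∧
    (Finset.univ.sup fun a => Nat.dist (mult x a) (mult y a)) = d}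

/-- The set of positions queried by a decision tree on an input. -/
def DTree.queried {n M : ℕ} : DTree n M → (Fin n → Fin M) → Finset (Fin n)
  | .leaf _, _ => ∅
  | .node i ts, x => insert i ((ts (x i)).queried x)

lemma DTree.card_queried_le {n M : ℕ} (t : DTree n M) (x : Fin n → Fin M) :
    (t.queried x).card ≤ t.depth := by
  induction t with
  | leaf b => simp [queried, depth]
  | node i ts ih =>
    have h : (ts (x i)).depth ≤ Finset.univ.sup fun a => (ts a).depth :=
      Finset.le_sup (f := fun a => (ts a).depth) (Finset.mem_univ (x i))
    calc _ ≤ ((ts (x i)).queried x).card + 1 := Finset.card_insert_le _ _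
      _ ≤ _ := by simpa [depth] using (ih (x i)).trans h

lemma DTree.eval_eq_of_queried {n M : ℕ} (t : DTree n M) (x y : Fin n → Fin M)
    (h : ∀ i ∈ t.queried x, y i = x i) : t.eval y = t.eval x := by
  induction t with
  | leaf b => rfl
  | node i ts ih =>
    have hi : y i = x i := h i (by simp [queried])
    simp only [eval, hi]
    exact ih (x i) fun j hj => h j (by simp [queried, hj])

/-- If two inputs differ only at `i` and `j`, and the tree queries `i` on the first input, then
it queries `j` on the first input or `i` on the second one. -/
lemma DTree.mem_queried_of_swap {n M : ℕ} (t : DTree n M) (x y : Fin n → Fin M) (i j : Fin n)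
    (h : ∀ l, l ≠ i → l ≠ j → y l = x l) (hi : i ∈ t.queried x) :
    j ∈ t.queried x ∨ i ∈ t.queried y := by
  induction t with
  | leaf b => simp [queried] at hi
  | node l ts ih =>
    by_cases hli : l = i
    · right; simp [queried, hli]
    by_cases hlj : l = j
    · left; simp [queried, hlj]
    have hl := h l hli hlj
    simp only [queried, Finset.mem_insert, hl] at hi ⊢
    rcases hi with hi | hi
    · exact absurd hi.symm hli
    · rcases ih _ hi with h' | h' <;> tauto

/-- The probability that a randomized algorithm queries the position `i` on the input `x`. -/
noncomputable def queryProb {n M : ℕ} (A : RandAlg n M) (x : Fin n → Fin M) (i : Fin n) : ℝ :=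
  ∑ j, A.prob j * if i ∈ (A.tree j).queried x then 1 else 0

lemma queryProb_nonneg {n M : ℕ} (A : RandAlg n M) (x : Fin n → Fin M) (i : Fin n) :
    0 ≤ queryProb A x i :=
  Finset.sum_nonneg fun j _ => mul_nonneg (A.nonneg j) (by split_ifs <;> norm_num)

lemma sum_queryProb_le {n M : ℕ} (A : RandAlg n M) (x : Fin n → Fin M) :
    ∑ i, queryProb A x i ≤ suppDepth A := by
  unfold queryProb
  rw [Finset.sum_comm]
  calc _ = ∑ j, A.prob j * (((A.tree j).queried x).card : ℝ) := by
        refine Finset.sum_congr rfl fun j _ => ?_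
        rw [← Finset.mul_sum]; simp
    _ ≤ ∑ j, A.prob j * (suppDepth A : ℝ) := by
        refine Finset.sum_le_sum fun j _ => ?_
        by_cases hj : A.prob j = 0
        · simp [hj]
        refine mul_le_mul_of_nonneg_left ?_ (A.nonneg j)
        refine Nat.cast_le.2 (((A.tree j).card_queried_le x).trans ?_)
        exact Finset.le_sup (f := fun j => (A.tree j).depth) (by simp [hj])
    _ = _ := by rw [← Finset.sum_mul, A.sum_one, one_mul]

lemma queryProb_swap_le {n M : ℕ} (A : RandAlg n M) (x y : Fin n → Fin M) (i j : Fin n)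
    (h : ∀ l, l ≠ i → l ≠ j → y l = x l) :
    queryProb A x i ≤ queryProb A x j + queryProb A y i := by
  unfold queryProb
  rw [← Finset.sum_add_distrib]
  refine Finset.sum_le_sum fun k _ => ?_
  rw [← mul_add]
  refine mul_le_mul_of_nonneg_left ?_ (A.nonneg k)
  have := (A.tree k).mem_queried_of_swap x y i j h
  split_ifs <;> first | (exfalso; tauto) | norm_num

/-- A bounded-error algorithm queries every sensitive block with probability at least `1/3`. -/
lemma one_third_le_sum_queryProb {n M : ℕ} {T : Set (Fin n → Fin M)}
    {f : (Fin n → Fin M) → Bool} {A : RandAlg n M} (hA : BoundedError T f A)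
    {x y : Fin n → Fin M} (hx : x ∈ T) (hy : y ∈ T) (hf : f y ≠ f x) (B : Finset (Fin n))
    (hB : ∀ i, y i ≠ x i → i ∈ B) : 1 / 3 ≤ ∑ i ∈ B, queryProb A x i := by
  have h1 := hA x hx
  have h2 := hA y hy
  rw [Finset.sum_filter] at h1 h2
  have h3 : ∑ j, A.prob j = 1 := A.sum_one
  unfold queryProb
  rw [Finset.sum_comm]
  suffices h : (∑ j, if (A.tree j).eval x = f x then A.prob j else 0)
      + (∑ j, if (A.tree j).eval y = f y then A.prob j else 0)
      ≤ (∑ j, A.prob j)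
        + ∑ j, ∑ i ∈ B, A.prob j * (if i ∈ (A.tree j).queried x then 1 else 0) by
    linarith
  rw [← Finset.sum_add_distrib, ← Finset.sum_add_distrib]
  refine Finset.sum_le_sum fun j _ => ?_
  have h0 := A.nonneg j
  have hs : ∀ i ∈ B, 0 ≤ A.prob j * (if i ∈ (A.tree j).queried x then (1 : ℝ) else 0) :=
    fun i _ => mul_nonneg h0 (by split_ifs <;> norm_num)
  have hs0 := Finset.sum_nonneg hs
  by_cases hhit : ∃ i ∈ B, i ∈ (A.tree j).queried x
  · obtain ⟨i, hiB, hi⟩ := hhit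
    have := Finset.single_le_sum hs hiB
    simp only [hi, if_true] at this
    split_ifs <;> linarith
  · push Not at hhit
    have he : (A.tree j).eval y = (A.tree j).eval x := by
      refine (A.tree j).eval_eq_of_queried x y fun i hi => ?_
      by_contra hne
      exact hhit i (hB i hne) hi
    rw [he]
    split_ifs with ha hb
    · exact absurd (hb.symm.trans ha) hf
    all_goals linarith

lemma exists_perm_of_typeOf_eq {n M : ℕ} {x y : Fin n → Fin M} (h : typeOf x = typeOf y) :
    ∃ σ : Equiv.Perm (Fin n), y ∘ σ = x := by
  have hc : ∀ a, Fintype.card {i // x i = a} = Fintype.card {i // y i = a} := by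
    intro a
    have := congrArg (Multiset.count a) h
    rw [typeOf, typeOf, Multiset.count_map, Multiset.count_map] at this
    rw [Fintype.card_subtype, Fintype.card_subtype]
    simpa [Finset.card, Finset.filter, eq_comm] using this
  refine ⟨(Equiv.sigmaFiberEquiv x).symm.trans ((Equiv.sigmaCongrRight fun a =>
    Fintype.equivOfCardEq (hc a)).trans (Equiv.sigmaFiberEquiv y)), ?_⟩
  ext i
  simp only [Function.comp, Equiv.trans_apply]
  have := ((Fintype.equivOfCardEq (hc (x i))) ⟨i, rfl⟩).2
  exact congrArg Fin.val this

/-- Strings of the same type are related by a permutation fixing every position where they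
agree. -/
lemma exists_perm_fixing {n M : ℕ} {x y : Fin n → Fin M} (h : typeOf x = typeOf y) :
    ∃ σ : Equiv.Perm (Fin n), y ∘ σ = x ∧ ∀ i, y i = x i → σ i = i := by
  obtain ⟨σ, hσ, hmin⟩ := Finset.exists_min_image
    (Finset.univ.filter fun σ : Equiv.Perm (Fin n) => y ∘ σ = x) (fun σ => σ.support.card)
    (by obtain ⟨σ, hσ⟩ := exists_perm_of_typeOf_eq h; exact ⟨σ, by simpa using hσ⟩)
  have hσ' : ∀ i, y (σ i) = x i := fun i => congrFun (by simpa using hσ) i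
  refine ⟨σ, by simpa using hσ, fun i hi => ?_⟩
  by_contra hne
  have hlt : (Equiv.swap i (σ i) * σ).support.card < σ.support.card :=
    Equiv.Perm.card_support_swap_mul hne
  refine absurd (hmin (Equiv.swap i (σ i) * σ) ?_) (not_le.2 hlt)
  simp only [Finset.mem_filter, Finset.mem_univ, true_and]
  ext j
  simp only [Function.comp, Equiv.Perm.mul_apply]
  by_cases hj : σ j = i
  · rw [hj, Equiv.swap_apply_left, hσ', ← hi, ← hj, hσ']
  · by_cases hji : j = i
    · subst hji; rw [Equiv.swap_apply_right, hi]
    · rw [Equiv.swap_apply_of_ne_of_ne hj (fun e => hji (σ.injective e)), hσ']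

lemma typeOf_comp_perm {n M : ℕ} (x : Fin n → Fin M) (σ : Equiv.Perm (Fin n)) :
    typeOf (x ∘ σ) = typeOf x := by
  unfold typeOf
  rw [← Multiset.map_map, Multiset.map_univ_val_equiv]

lemma IsTypePromise.comp_mem {n M : ℕ} {T : Set (Fin n → Fin M)} (hT : IsTypePromise T)
    {x : Fin n → Fin M} (hx : x ∈ T) (σ : Equiv.Perm (Fin n)) : x ∘ σ ∈ T := by
  obtain ⟨x₀, rfl⟩ := hT
  exact (typeOf_comp_perm x σ).trans hx

lemma IsTypePromise.exists_perm {n M : ℕ} {T : Set (Fin n → Fin M)} (hT : IsTypePromise T)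
    {x y : Fin n → Fin M} (hx : x ∈ T) (hy : y ∈ T) :
    ∃ σ : Equiv.Perm (Fin n), y ∘ σ = x ∧ ∀ i, y i = x i → σ i = i := by
  obtain ⟨x₀, rfl⟩ := hT
  exact exists_perm_fixing (Eq.trans hx (Eq.symm hy))

/-- Greedy covering: if every set that is not good can be extended by a disjoint set of at most
`b` points and weight at least `1 / m`, then there is a small good set. -/
lemma exists_good_of_extend {ι : Type*} [Fintype ι] [DecidableEq ι] (w : ι → ℝ)
    (hw : ∀ i, 0 ≤ w i) (W m b : ℕ) (hW : ∑ i, w i ≤ W) (Good : Finset ι → Prop)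
    (step : ∀ U, ¬ Good U → ∃ B, Disjoint U B ∧ B.card ≤ b ∧ 1 ≤ m * ∑ i ∈ B, w i) :
    ∃ U, Good U ∧ U.card ≤ m * W * b := by
  by_contra! hno
  have key : ∀ j, j ≤ m * W + 1 → ∃ U : Finset ι, U.card ≤ j * b ∧ (j : ℝ) ≤ m * ∑ i ∈ U, w i := by
    intro j
    induction j with
    | zero => exact fun _ => ⟨∅, by simp⟩
    | succ j ih =>
      intro hj
      obtain ⟨U, hU, hUw⟩ := ih (by omega)
      have hbad : ¬ Good U := fun hg => by
        have := Nat.mul_le_mul_right b (show j ≤ m * W by omega)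
        exact absurd (hno U hg) (by omega)
      obtain ⟨B, hd, hB, hBw⟩ := step U hbad
      refine ⟨U ∪ B, ?_, ?_⟩
      · rw [Finset.card_union_of_disjoint hd, add_mul]; omega
      · rw [Finset.sum_union hd, mul_add]; push_cast; linarith
  obtain ⟨U, -, hU⟩ := key (m * W + 1) le_rfl
  have h1 : ∑ i ∈ U, w i ≤ W :=
    (Finset.sum_le_univ_sum_of_nonneg hw).trans hW
  have := mul_le_mul_of_nonneg_left h1 (Nat.cast_nonneg (α := ℝ) m)
  push_cast at hU
  linarith

/-- `S` supports a certificate at `y`. -/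
def IsCertSet {n M : ℕ} (T : Set (Fin n → Fin M)) (f : (Fin n → Fin M) → Bool)
    (y : Fin n → Fin M) (S : Finset (Fin n)) : Prop :=
  ∀ z ∈ T, (∀ i ∈ S, z i = y i) → f z = f y

/-- A sensitive input with minimal difference set has a difference set of size at most
six times the depth of a bounded-error algorithm. -/
lemma card_minimal_sensitive_le {n M : ℕ} {T : Set (Fin n → Fin M)} (hT : IsTypePromise T)
    {f : (Fin n → Fin M) → Bool} {A : RandAlg n M} (hA : BoundedError T f A)
    {x y : Fin n → Fin M} (hx : x ∈ T) (hy : y ∈ T) (hf : f y ≠ f x)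
    (hmin : ∀ z ∈ T, (Finset.univ.filter fun i => z i ≠ x i) ⊂
      (Finset.univ.filter fun i => y i ≠ x i) → f z = f x) :
    (Finset.univ.filter fun i => y i ≠ x i).card ≤ 6 * suppDepth A := by
  set B := Finset.univ.filter fun i => y i ≠ x i with hB
  obtain ⟨σ, hσ, hfix⟩ := hT.exists_perm hx hy
  have hσ' : ∀ i, y (σ i) = x i := fun i => congrFun hσ i
  have hpair : ∀ i ∈ B, 1 / 3 ≤ queryProb A y i + queryProb A y (σ i) := by
    intro i hi
    have hne : y i ≠ x i := by simpa [hB] using hi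
    have hij : i ≠ σ i := fun e => hne (by rw [← hσ' i, ← e])
    have hz : f (y ∘ Equiv.swap i (σ i)) = f x := by
      refine hmin _ (hT.comp_mem hy _) (Finset.ssubset_iff_of_subset ?_ |>.2 ⟨i, hi, ?_⟩)
      · intro l hl
        simp only [Finset.mem_filter, Finset.mem_univ, true_and, Function.comp, hB] at hl ⊢
        by_cases hli : l = i
        · rwa [hli]
        by_cases hlj : l = σ i
        · intro e
          have := hfix l e
          rw [hlj] at this
          exact hij (σ.injective this).symm
        · rwa [Equiv.swap_apply_of_ne_of_ne hli hlj] at hl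
      · simp [hσ']
    rw [← Finset.sum_pair hij]
    refine one_third_le_sum_queryProb hA hy (hT.comp_mem hy (Equiv.swap i (σ i)))
      (by rw [hz]; exact hf.symm) _ fun l hl => ?_
    by_contra hl'
    simp only [Finset.mem_insert, Finset.mem_singleton, not_or] at hl'
    exact hl (by simp [Equiv.swap_apply_of_ne_of_ne hl'.1 hl'.2])
  have h1 : ∑ i ∈ B, queryProb A y i ≤ suppDepth A :=
    (Finset.sum_le_univ_sum_of_nonneg (queryProb_nonneg A y)).trans (sum_queryProb_le A y)
  have h2 : ∑ i ∈ B, queryProb A y (σ i) ≤ suppDepth A := by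
    refine (Finset.sum_le_univ_sum_of_nonneg fun i => queryProb_nonneg A y (σ i)).trans ?_
    rw [Equiv.sum_comp σ (queryProb A y)]
    exact sum_queryProb_le A y
  have h3 := Finset.sum_le_sum hpair
  rw [Finset.sum_const, Finset.sum_add_distrib, nsmul_eq_mul] at h3
  have : (B.card : ℝ) ≤ ((6 * suppDepth A : ℕ) : ℝ) := by push_cast; linarith
  exact_mod_cast this

/-- On a type promise, certificate complexity is quadratically bounded by the depth of any
bounded-error algorithm. -/
lemma exists_certSet {n M : ℕ} {T : Set (Fin n → Fin M)} (hT : IsTypePromise T)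
    {f : (Fin n → Fin M) → Bool} {A : RandAlg n M} (hA : BoundedError T f A)
    {x : Fin n → Fin M} (hx : x ∈ T) :
    ∃ S, IsCertSet T f x S ∧ S.card ≤ 3 * suppDepth A * (6 * suppDepth A) := by
  refine exists_good_of_extend (queryProb A x) (queryProb_nonneg A x) _ 3 _
    (sum_queryProb_le A x) (IsCertSet T f x) fun U hU => ?_
  simp only [IsCertSet, not_forall] at hU
  obtain ⟨y₀, hy₀, hyU₀, hf₀⟩ := hU
  obtain ⟨y, hy, hmin⟩ := Finset.exists_min_image
    (Finset.univ.filter fun y => y ∈ T ∧ f y ≠ f x ∧ ∀ i ∈ U, y i = x i)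
    (fun y => (Finset.univ.filter fun i => y i ≠ x i).card) ⟨y₀, by simp; tauto⟩
  simp only [Finset.mem_filter, Finset.mem_univ, true_and] at hy hmin
  obtain ⟨hyT, hfy, hyU⟩ := hy
  refine ⟨Finset.univ.filter fun i => y i ≠ x i, ?_, ?_, ?_⟩
  · rw [Finset.disjoint_left]
    intro i hi
    simpa using hyU i hi
  · refine card_minimal_sensitive_le hT hA hx hyT hfy fun z hz hlt => ?_
    by_contra hfz
    refine absurd (Finset.card_lt_card hlt) (not_lt.2 (hmin z ⟨hz, hfz, fun i hi => ?_⟩))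
    by_contra hzi
    have := hlt.1 (show i ∈ Finset.univ.filter fun i => z i ≠ x i by simpa using hzi)
    exact (Finset.mem_filter.1 this).2 (hyU i hi)
  · have := one_third_le_sum_queryProb hA hx hyT hfy (Finset.univ.filter fun i => y i ≠ x i)
      (by simp)
    push_cast
    linarith

/-- The permutations fixing every point of `P`. -/
noncomputable def permsFixing {n : ℕ} (P : Finset (Fin n)) : Finset (Equiv.Perm (Fin n)) :=
  Finset.univ.filter fun σ => ∀ i ∈ P, σ i = i

lemma mem_permsFixing {n : ℕ} {P : Finset (Fin n)} {σ : Equiv.Perm (Fin n)} :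
    σ ∈ permsFixing P ↔ ∀ i ∈ P, σ i = i := by simp [permsFixing]

lemma card_permsFixing_pos {n : ℕ} (P : Finset (Fin n)) : 0 < (permsFixing P).card :=
  Finset.card_pos.2 ⟨1, by simp [mem_permsFixing]⟩

lemma sum_permsFixing_mul_left {n : ℕ} {P : Finset (Fin n)} {τ : Equiv.Perm (Fin n)}
    (hτ : τ ∈ permsFixing P) (g : Equiv.Perm (Fin n) → ℝ) :
    ∑ σ ∈ permsFixing P, g (τ * σ) = ∑ σ ∈ permsFixing P, g σ := by
  refine Finset.sum_equiv (Equiv.mulLeft τ) (fun σ => ?_) fun σ _ => rfl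
  rw [mem_permsFixing] at hτ
  simp only [mem_permsFixing, Equiv.coe_mulLeft, Equiv.Perm.mul_apply]
  refine forall₂_congr fun i hi => ⟨fun h => by rw [h, hτ i hi], fun h => ?_⟩
  exact τ.injective (h.trans (hτ i hi).symm)

/-- A permutation can be made to fix `S` by changing it only on `S` and its preimage. -/
lemma exists_perm_fixing_insert {n : ℕ} {P : Finset (Fin n)} {σ : Equiv.Perm (Fin n)}
    (hσ : σ ∈ permsFixing P) (S : Finset (Fin n)) :
    ∃ τ ∈ permsFixing (P ∪ S), ∀ i, τ i ≠ σ i → i ∈ S ∨ σ i ∈ S := by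
  induction S using Finset.induction_on with
  | empty => exact ⟨σ, by simpa using hσ, by simp⟩
  | insert s S hs ih =>
    obtain ⟨τ, hτ, hd⟩ := ih
    rw [mem_permsFixing] at hτ
    refine ⟨Equiv.swap s (τ s) * τ, mem_permsFixing.2 fun i hi => ?_, fun i hi => ?_⟩
    · by_cases his : i = s
      · subst his; simp
      have hiτ : τ i = i := hτ i (by simp at hi ⊢; tauto)
      rw [Equiv.Perm.mul_apply, Equiv.swap_apply_of_ne_of_ne (by rwa [hiτ])
        fun e => his (τ.injective e), hiτ]
    · simp only [Finset.mem_insert]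
      by_cases hne : τ i = σ i
      · rw [Equiv.Perm.mul_apply] at hi
        by_contra! hno
        rw [Equiv.swap_apply_of_ne_of_ne (by rw [hne]; exact hno.2.1)
          fun e => hno.1.1 (τ.injective e)] at hi
        exact hi hne
      · rcases hd i hne with h | h <;> tauto

/-- A fixed symbol of a random permutation is queried with small probability. -/
lemma card_mul_sum_queryProb_le {n M : ℕ} (A : RandAlg n M) (z : Fin n → Fin M)
    (P : Finset (Fin n)) {s : Fin n} (hs : s ∉ P) :
    (Pᶜ.card : ℝ) * ∑ σ ∈ permsFixing P, queryProb A (z ∘ σ) (σ.symm s)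
      ≤ 2 * ((permsFixing P).card * suppDepth A) := by
  have hR : ∑ σ ∈ permsFixing P, ∑ v ∈ Pᶜ, queryProb A (z ∘ σ) (σ.symm v)
      ≤ (permsFixing P).card * suppDepth A := by
    rw [← nsmul_eq_mul]
    refine Finset.sum_le_card_nsmul _ _ _ fun σ _ => ?_
    refine (Finset.sum_le_univ_sum_of_nonneg fun v => queryProb_nonneg A _ _).trans ?_
    rw [Equiv.sum_comp σ.symm (queryProb A (z ∘ σ))]
    exact sum_queryProb_le A _
  have hv : ∀ v ∈ Pᶜ, ∑ σ ∈ permsFixing P, queryProb A (z ∘ σ) (σ.symm s)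
      ≤ 2 * ∑ σ ∈ permsFixing P, queryProb A (z ∘ σ) (σ.symm v) := by
    intro v hv
    have hswap : Equiv.swap s v ∈ permsFixing P := mem_permsFixing.2 fun i hi =>
      Equiv.swap_apply_of_ne_of_ne (fun e => hs (e ▸ hi)) fun e => by simp [← e, hi] at hv
    rw [two_mul]
    nth_rewrite 3 [← sum_permsFixing_mul_left hswap]
    rw [← Finset.sum_add_distrib]
    refine Finset.sum_le_sum fun σ _ => ?_
    have he : (Equiv.swap s v * σ).symm v = σ.symm s := by
      rw [Equiv.symm_apply_eq]; simp
    rw [he]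
    refine queryProb_swap_le A _ _ _ _ fun l hl hl' => ?_
    simp only [Function.comp, Equiv.Perm.mul_apply]
    rw [Equiv.swap_apply_of_ne_of_ne (fun e => hl (by simp [← e])) fun e => hl' (by simp [← e])]
  calc _ = ∑ v ∈ Pᶜ, ∑ σ ∈ permsFixing P, queryProb A (z ∘ σ) (σ.symm s) := by
        rw [Finset.sum_const, nsmul_eq_mul]
    _ ≤ ∑ v ∈ Pᶜ, 2 * ∑ σ ∈ permsFixing P, queryProb A (z ∘ σ) (σ.symm v) :=
        Finset.sum_le_sum hv
    _ = 2 * ∑ σ ∈ permsFixing P, ∑ v ∈ Pᶜ, queryProb A (z ∘ σ) (σ.symm v) := by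
        rw [← Finset.mul_sum, Finset.sum_comm]
    _ ≤ _ := by linarith

/-- If at least half of the completions of `x` on `P` have value different from `b`, then the
free part of every certificate for `b` is queried with constant probability on a random
completion. -/
lemma one_le_sum_sum_queryProb {n M : ℕ} {T : Set (Fin n → Fin M)} (hT : IsTypePromise T)
    {f : (Fin n → Fin M) → Bool} {A : RandAlg n M} (hA : BoundedError T f A) {k : ℕ}
    {x y : Fin n → Fin M} (hx : x ∈ T) (hy : y ∈ T) {P S : Finset (Fin n)}
    (hn : 24 * suppDepth A * k ≤ Pᶜ.card) (hxy : ∀ i ∈ P, y i = x i)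
    (hS : IsCertSet T f y S) (hSk : S.card ≤ k)
    (hmaj : (permsFixing P).card ≤
      2 * ((permsFixing P).filter fun σ : Equiv.Perm (Fin n) => f (x ∘ σ) ≠ f y).card) :
    ((permsFixing P).card : ℝ) ≤
      12 * ∑ σ ∈ permsFixing P, ∑ i ∈ S \ P, queryProb A (x ∘ σ) i := by
  set G := permsFixing P with hG
  obtain ⟨τ, hτ, hτP⟩ := hT.exists_perm hy hx
  have hτG : τ ∈ G := mem_permsFixing.2 fun i hi => hτP i (hxy i hi).symm
  have hcomp : ∀ σ : Equiv.Perm (Fin n), y ∘ σ = x ∘ (τ * σ) := by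
    intro σ; rw [← hτ]; rfl
  have hcount : ∑ σ ∈ G, (if f (y ∘ σ) ≠ f y then (1 / 3 : ℝ) else 0)
      = ((G.filter fun σ : Equiv.Perm (Fin n) => f (x ∘ σ) ≠ f y).card : ℝ) / 3 := by
    simp only [hcomp]
    rw [sum_permsFixing_mul_left hτG fun σ : Equiv.Perm (Fin n) => if f (x ∘ σ) ≠ f y then (1 / 3 : ℝ) else 0,
      ← Finset.sum_filter, Finset.sum_const, nsmul_eq_mul]
    ring
  have hpt : ∀ σ ∈ G, (if f (y ∘ σ) ≠ f y then (1 / 3 : ℝ) else 0) ≤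
      ∑ i ∈ S \ P, queryProb A (y ∘ σ) i + ∑ s ∈ S \ P, queryProb A (y ∘ σ) (σ.symm s) := by
    intro σ hσ
    have h1 := Finset.sum_nonneg fun i (_ : i ∈ S \ P) => queryProb_nonneg A (y ∘ σ) i
    have h2 := Finset.sum_nonneg fun s (_ : s ∈ S \ P) => queryProb_nonneg A (y ∘ σ) (σ.symm s)
    split_ifs with hf
    swap
    · linarith
    obtain ⟨ρ, hρ, hd⟩ := exists_perm_fixing_insert hσ (S \ P)
    rw [mem_permsFixing] at hρ
    have hfρ : f (y ∘ ρ) = f y := by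
      refine hS _ (hT.comp_mem hy ρ) fun i hi => ?_
      simp only [Function.comp]
      rw [hρ i (by simp [hi])]
    have h3 := one_third_le_sum_queryProb hA (hT.comp_mem hy σ) (hT.comp_mem hy ρ)
      (by rw [hfρ]; exact hf.symm) ((S \ P) ∪ (S \ P).image σ.symm) (by
        intro i hi
        have hne : ρ i ≠ σ i := fun e => hi (by simp [e])
        rw [Finset.mem_union, Finset.mem_image]
        rcases hd i hne with h | h
        · exact Or.inl h
        · exact Or.inr ⟨σ i, h, by simp⟩)
    refine h3.trans ?_
    rw [← Finset.sum_image (s := S \ P) (g := σ.symm) (f := queryProb A (y ∘ σ))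
      (σ.symm.injective.injOn), ← Finset.sum_union_inter]
    have := Finset.sum_nonneg fun i (_ : i ∈ (S \ P) ∩ (S \ P).image σ.symm) =>
      queryProb_nonneg A (y ∘ σ) i
    linarith
  have hsum := Finset.sum_le_sum hpt
  rw [hcount, Finset.sum_add_distrib] at hsum
  have hfirst : ∑ σ ∈ G, ∑ i ∈ S \ P, queryProb A (y ∘ σ) i
      = ∑ σ ∈ G, ∑ i ∈ S \ P, queryProb A (x ∘ σ) i := by
    simp only [hcomp]
    exact sum_permsFixing_mul_left hτG fun σ => ∑ i ∈ S \ P, queryProb A (x ∘ σ) i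
  have hsecond : ∑ σ ∈ G, ∑ s ∈ S \ P, queryProb A (y ∘ σ) (σ.symm s) ≤ G.card / 12 := by
    rcases (S \ P).eq_empty_or_nonempty with he | ⟨s₀, hs₀⟩
    · simp only [he, Finset.sum_empty, Finset.sum_const_zero]; positivity
    have hpos : (0 : ℝ) < Pᶜ.card := by
      exact_mod_cast Finset.card_pos.2 ⟨s₀, by simp at hs₀ ⊢; exact hs₀.2⟩
    rw [Finset.sum_comm]
    refine le_of_mul_le_mul_left ?_ hpos
    rw [Finset.mul_sum]
    have hle := Finset.sum_le_card_nsmul (S \ P) _ _ fun s hs =>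
      card_mul_sum_queryProb_le A y P (s := s) (Finset.mem_sdiff.1 hs).2
    refine hle.trans ?_
    rw [nsmul_eq_mul, ← hG]
    have hc : ((S \ P).card : ℝ) ≤ k := by
      exact_mod_cast (Finset.card_le_card Finset.sdiff_subset).trans hSk
    have hn' : (24 * suppDepth A * k : ℝ) ≤ Pᶜ.card := by exact_mod_cast hn
    have hGn : (0 : ℝ) ≤ G.card := Nat.cast_nonneg _
    have hRn : (0 : ℝ) ≤ suppDepth A := Nat.cast_nonneg _
    calc _ ≤ (k : ℝ) * (2 * (G.card * suppDepth A)) := by gcongr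
      _ = (24 * suppDepth A * k : ℝ) * (G.card / 12) := by ring
      _ ≤ _ := by gcongr
  have hmaj' : (G.card : ℝ) ≤ 2 * ((G.filter fun σ : Equiv.Perm (Fin n) => f (x ∘ σ) ≠ f y).card : ℝ) := by
    exact_mod_cast hmaj
  rw [hfirst] at hsum
  linarith

/-- If at least half of the completions of `x` on `P` have value different from `b`, then a small
set of positions meets the free part of every small certificate for `b`. -/
lemma exists_hittingSet {n M : ℕ} {T : Set (Fin n → Fin M)} (hT : IsTypePromise T)
    {f : (Fin n → Fin M) → Bool} {A : RandAlg n M} (hA : BoundedError T f A) {k : ℕ}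
    {x : Fin n → Fin M} (hx : x ∈ T) {P : Finset (Fin n)}
    (hn : 24 * suppDepth A * k ≤ Pᶜ.card) (b : Bool)
    (hmaj : (permsFixing P).card ≤
      2 * ((permsFixing P).filter fun σ : Equiv.Perm (Fin n) => f (x ∘ σ) ≠ b).card) :
    ∃ U : Finset (Fin n), (∀ y ∈ T, (∀ i ∈ P, y i = x i) → f y = b →
      ∀ S, IsCertSet T f y S → S.card ≤ k → ¬ Disjoint U (S \ P)) ∧
      U.card ≤ 12 * suppDepth A * k := by
  have hG : (0 : ℝ) < (permsFixing P).card := by exact_mod_cast card_permsFixing_pos P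
  refine exists_good_of_extend
    (fun i => (∑ σ ∈ permsFixing P, queryProb A (x ∘ σ) i) / (permsFixing P).card)
    (fun i => div_nonneg (Finset.sum_nonneg fun σ _ => queryProb_nonneg A _ _) hG.le)
    _ 12 _ ?_ _ fun U hU => ?_
  · rw [← Finset.sum_div, Finset.sum_comm, div_le_iff₀ hG, mul_comm, ← nsmul_eq_mul]
    exact Finset.sum_le_card_nsmul _ _ _ fun σ _ => sum_queryProb_le A _
  · push Not at hU
    obtain ⟨y, hy, hxy, rfl, S, hS, hSk, hd⟩ := hU
    refine ⟨S \ P, hd, (Finset.card_le_card Finset.sdiff_subset).trans hSk, ?_⟩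
    have := one_le_sum_sum_queryProb hT hA hx hy hn hxy hS hSk hmaj
    rw [← Finset.sum_div, Finset.sum_comm, ← mul_div_assoc, one_le_div hG]
    exact_mod_cast this

/-- Querying all positions of `U` before continuing. -/
lemma exists_tree_of_query {n M : ℕ} (f : (Fin n → Fin M) → Bool) (d : ℕ) (U : Finset (Fin n)) :
    ∀ X : Set (Fin n → Fin M),
    (∀ x ∈ X, ∃ t : DTree n M, t.depth ≤ d ∧ Computes {y ∈ X | ∀ i ∈ U, y i = x i} f t) →
    ∃ t : DTree n M, t.depth ≤ U.card + d ∧ Computes X f t := by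
  induction U using Finset.induction_on with
  | empty =>
    intro X h
    rcases X.eq_empty_or_nonempty with rfl | ⟨x, hx⟩
    · exact ⟨.leaf true, by simp [DTree.depth], by simp [Computes]⟩
    · simpa using h x hx
  | insert i U hi ih =>
    intro X h
    have : ∀ a : Fin M, ∃ t : DTree n M, t.depth ≤ U.card + d ∧
        Computes {y ∈ X | y i = a} f t := by
      refine fun a => ih _ fun x hx => ?_
      obtain ⟨t, ht, hc⟩ := h x hx.1
      refine ⟨t, ht, fun y hy => hc y ⟨hy.1.1, fun j hj => ?_⟩⟩
      rcases Finset.mem_insert.1 hj with rfl | hj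
      · exact hy.1.2.trans hx.2.symm
      · exact hy.2 j hj
    choose ts hts hc using this
    refine ⟨.node i ts, ?_, fun y hy => hc (y i) y ⟨hy, rfl⟩⟩
    rw [Finset.card_insert_of_notMem hi]
    have : (Finset.univ.sup fun a => (ts a).depth) ≤ U.card + d :=
      Finset.sup_le fun a _ => hts a
    simp only [DTree.depth]
    omega

lemma exists_majority {n M : ℕ} (f : (Fin n → Fin M) → Bool) (x : Fin n → Fin M)
    (P : Finset (Fin n)) : ∃ b : Bool, (permsFixing P).card ≤
      2 * ((permsFixing P).filter fun σ : Equiv.Perm (Fin n) => f (x ∘ σ) ≠ b).card := by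
  have hsum := Finset.card_filter_add_card_filter_not (s := permsFixing P)
    (fun σ : Equiv.Perm (Fin n) => f (x ∘ σ) ≠ true)
  have heq : (permsFixing P).filter (fun σ : Equiv.Perm (Fin n) => ¬ f (x ∘ σ) ≠ true) =
      (permsFixing P).filter fun σ : Equiv.Perm (Fin n) => f (x ∘ σ) ≠ false :=
    Finset.filter_congr fun σ _ => by simp
  rw [heq] at hsum
  by_contra! h
  have h1 := h true
  have h2 := h false
  omega

/-- The decision tree repeatedly queries a set hitting all certificates of the less likely
value; `c b` bounds the number of unqueried positions in the certificates for `b`. -/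
lemma exists_tree_of_certSets {n M : ℕ} {T : Set (Fin n → Fin M)} (hT : IsTypePromise T)
    {f : (Fin n → Fin M) → Bool} {A : RandAlg n M} (hA : BoundedError T f A) (k m : ℕ) :
    ∀ (c : Bool → ℕ) (P : Finset (Fin n)) (x : Fin n → Fin M), x ∈ T →
    c true + c false = m →
    (∀ y ∈ T, (∀ i ∈ P, y i = x i) →
      ∃ S, IsCertSet T f y S ∧ S.card ≤ k ∧ (S \ P).card ≤ c (f y)) →
    24 * suppDepth A * k + m * (12 * suppDepth A * k) + P.card ≤ n →
    ∃ t : DTree n M, t.depth ≤ m * (12 * suppDepth A * k) ∧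
      Computes {y ∈ T | ∀ i ∈ P, y i = x i} f t := by
  induction m with
  | zero =>
    intro c P x hx hc hcert _
    refine ⟨.leaf (f x), by simp [DTree.depth], fun y hy => ?_⟩
    obtain ⟨S, hS, -, hSP⟩ := hcert x hx fun _ _ => rfl
    have hc0 : c (f x) = 0 := by cases f x <;> omega
    have hsub : S ⊆ P := by
      rw [← Finset.sdiff_eq_empty_iff_subset, ← Finset.card_eq_zero]; omega
    exact (hS y hy.1 fun i hi => hy.2 i (hsub hi)).symm
  | succ m ih =>
    intro c P x hx hc hcert hn
    by_cases hconst : ∃ b, ∀ y ∈ T, (∀ i ∈ P, y i = x i) → f y = b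
    · obtain ⟨b, hb⟩ := hconst
      exact ⟨.leaf b, by simp [DTree.depth], fun y hy => (hb y hy.1 hy.2).symm⟩
    obtain ⟨b, hb⟩ := exists_majority f x P
    have hPc : Pᶜ.card = n - P.card := by simp [Finset.card_compl]
    obtain ⟨U, hU, hUc⟩ := exists_hittingSet hT hA (k := k) hx (by rw [hPc]; omega) b hb
    have hlt : ∀ y ∈ T, (∀ i ∈ P, y i = x i) → f y = b → ∀ S, IsCertSet T f y S →
        S.card ≤ k → (S \ (P ∪ U)).card < (S \ P).card := by
      intro y hy hyx hfy S hS hSk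
      obtain ⟨i, hiU, hiS⟩ := Finset.not_disjoint_iff.1 (hU y hy hyx hfy S hS hSk)
      refine Finset.card_lt_card (Finset.ssubset_iff_of_subset ?_ |>.2 ⟨i, hiS, by simp [hiU]⟩)
      exact Finset.sdiff_subset_sdiff subset_rfl Finset.subset_union_left
    have hcb : 1 ≤ c b := by
      by_contra hcb
      refine hconst ⟨!b, fun y hy hyx => ?_⟩
      by_contra hfy
      have hfy : f y = b := by simpa using hfy
      obtain ⟨S, hS, hSk, hSP⟩ := hcert y hy hyx
      have := hlt y hy hyx hfy S hS hSk
      rw [hfy] at hSP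
      omega
    have hsum : Function.update c b (c b - 1) true + Function.update c b (c b - 1) false = m := by
      cases b <;> simp [Function.update] <;> omega
    obtain ⟨t, ht, htc⟩ := exists_tree_of_query f (m * (12 * suppDepth A * k)) U
      {y ∈ T | ∀ i ∈ P, y i = x i} (by
        rintro z ⟨hz, hzx⟩
        obtain ⟨t, ht, htc⟩ := ih (Function.update c b (c b - 1)) (P ∪ U) z hz hsum (by
            intro y hy hyz
            have hyx : ∀ i ∈ P, y i = x i := fun i hi =>
              (hyz i (by simp [hi])).trans (hzx i hi)
            obtain ⟨S, hS, hSk, hSP⟩ := hcert y hy hyx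
            refine ⟨S, hS, hSk, ?_⟩
            by_cases hfy : f y = b
            · have := hlt y hy hyx hfy S hS hSk
              rw [hfy] at hSP ⊢
              simp only [Function.update_self]
              omega
            · rw [Function.update_of_ne hfy]
              exact (Finset.card_le_card (Finset.sdiff_subset_sdiff subset_rfl
                Finset.subset_union_left)).trans hSP) (by
            have := Finset.card_union_le P U
            rw [add_mul, one_mul] at hn
            omega)
        refine ⟨t, ht, fun y hy => htc y ⟨hy.1.1, fun i hi => ?_⟩⟩
        rcases Finset.mem_union.1 hi with hi | hi
        · exact (hy.1.2 i hi).trans (hzx i hi).symm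
        · exact hy.2 i hi)
    refine ⟨t, ht.trans ?_, htc⟩
    rw [add_mul, one_mul]
    omega

lemma detD_le {n M : ℕ} {T : Set (Fin n → Fin M)} {f : (Fin n → Fin M) → Bool}
    {t : DTree n M} (ht : Computes T f t) : detD T f ≤ t.depth :=
  Nat.sInf_le ⟨t, ht, rfl⟩

lemma exists_tree_depth_le {n M : ℕ} (T : Set (Fin n → Fin M)) (f : (Fin n → Fin M) → Bool) :
    ∃ t : DTree n M, t.depth ≤ n ∧ Computes T f t := by
  have h := exists_tree_of_query f 0 Finset.univ T fun x _ =>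
    ⟨.leaf (f x), by simp [DTree.depth], fun y hy => by
      rw [show y = x from funext fun i => hy.2 i (Finset.mem_univ i)]; rfl⟩
  simpa using h

lemma exists_boundedError_suppDepth_eq {n M : ℕ} (T : Set (Fin n → Fin M))
    (f : (Fin n → Fin M) → Bool) :
    ∃ A : RandAlg n M, BoundedError T f A ∧ suppDepth A = randR T f := by
  refine Nat.sInf_mem (s := {d | ∃ A : RandAlg n M, BoundedError T f A ∧ suppDepth A = d}) ?_
  obtain ⟨t, -, ht⟩ := exists_tree_depth_le T f
  refine ⟨_, ⟨1, fun _ => t, fun _ => 1, fun _ => zero_le_one, by simp⟩, fun x hx => ?_, rfl⟩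
  simp [ht x hx]
  norm_num

/-- On a type promise, `D(f) = O(R(f) ^ 5)`. -/
lemma detD_le_randR_pow {n M : ℕ} {T : Set (Fin n → Fin M)} (hT : IsTypePromise T)
    (f : (Fin n → Fin M) → Bool) : detD T f ≤ 15552 * randR T f ^ 5 := by
  obtain ⟨A, hA, hR⟩ := exists_boundedError_suppDepth_eq T f
  rw [← hR]
  set R := suppDepth A with hRdef
  set k := 3 * R * (6 * R) with hk
  by_cases hn : 24 * R * k + (k + k) * (12 * R * k) ≤ n
  · obtain ⟨x, hx⟩ : T.Nonempty := by
      obtain ⟨x₀, rfl⟩ := hT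
      exact ⟨x₀, rfl⟩
    obtain ⟨t, ht, htc⟩ := exists_tree_of_certSets hT hA k (k + k) (fun _ => k) ∅ x hx rfl
      (fun y hy _ => by
        obtain ⟨S, hS, hSk⟩ := exists_certSet hT hA hy
        exact ⟨S, hS, hSk, by simpa using hSk⟩) (by simpa using hn)
    refine (detD_le (t := t) (by simpa using htc)).trans (ht.trans ?_)
    rw [← hRdef, hk]
    ring_nf
    omega
  · obtain ⟨t, ht, htc⟩ := exists_tree_depth_le T f
    refine (detD_le htc).trans (ht.trans ((not_le.1 hn).le.trans ?_))
    have h3 : R ^ 3 ≤ R ^ 5 := by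
      rcases Nat.eq_zero_or_pos R with h | h
      · simp [h]
      · exact Nat.pow_le_pow_right h (by norm_num)
    rw [hk]
    ring_nf
    omega

/-- on a type promise, `R(f) ≥ c · D(f)^{1/6}`. -/
theorem randR_ge_detD_sixth : ∃ c : ℝ, 0 < c ∧
    ∀ (n M : ℕ), 1 ≤ n → 1 ≤ M →
    ∀ T : Set (Fin n → Fin M), IsTypePromise T →
    ∀ f : (Fin n → Fin M) → Bool,
      c * (detD T f : ℝ) ^ ((1 : ℝ) / 6) ≤ (randR T f : ℝ) := by
  refine ⟨1 / 15552, by norm_num, fun n M _ _ T hT f => ?_⟩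
  have h : detD T f ≤ (15552 * randR T f) ^ 6 := by
    refine (detD_le_randR_pow hT f).trans ?_
    rw [mul_pow]
    refine Nat.mul_le_mul (by norm_num) ?_
    rcases Nat.eq_zero_or_pos (randR T f) with h | h
    · simp [h]
    · exact Nat.pow_le_pow_right h (by norm_num)
  have h' : (detD T f : ℝ) ≤ (15552 * randR T f : ℝ) ^ 6 := by exact_mod_cast h
  have h6 : (detD T f : ℝ) ^ ((1 : ℝ) / 6) ≤ 15552 * randR T f := by
    refine (Real.rpow_le_rpow (Nat.cast_nonneg _) h' (by norm_num)).trans_eq ?_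
    rw [one_div]
    exact_mod_cast Real.pow_rpow_inv_natCast
      (x := 15552 * randR T f) (n := 6) (by positivity) (by norm_num)
  linarith

end QCPaper
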